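/- arXiv:2311.14156 — 4 statements merged into one kernel-verified Lean document; each statement's English description precedes it below -/
import Mathlib

section
/- Let S be a nonempty finite set, E : S → [0,1], β* ∈ ℝ, δ ∈ (0,1), and m ≥ 1. Draw m i.i.d. samples s_1,…,s_m from the Boltzmann distribution p(β*) and let p̂ be the resulting empirical distribution. Set λ = √(ln(2/δ)/(2m)) and let β̂ ∈ ℝ be any minimizer of β ↦ L_p̂(β) + λ|β|, where L_p̂(β) = −Σ_{σ∈S} p̂(σ) log p(β)(σ) is the cross-entropy between p̂ and p(β). Then with probability at least 1 − δ over the samples, the Kullback–Leibler divergence satisfies D_KL(p(β*) ‖ p(β̂)) ≤ (|β*|/√m)·√(2 ln(2/δ)). -/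
open scoped BigOperators

/-- The Boltzmann distribution at inverse temperature `β` for energy `E`. -/
noncomputable def boltz {S : Type*} [Fintype S] (E : S → ℝ) (β : ℝ) (σ : S) : ℝ :=
  Real.exp (-β * E σ) / ∑ σ' : S, Real.exp (-β * E σ')

/-- Cross-entropy `L_q(β)` between a distribution `q` and the Boltzmann distribution `p(β)`. -/
noncomputable def crossEnt {S : Type*} [Fintype S] (q : S → ℝ) (E : S → ℝ) (β : ℝ) : ℝ :=
  -∑ σ : S, q σ * Real.log (boltz E β σ)

/-- Kullback–Leibler divergence between distributions on a finite set. -/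
noncomputable def klDiv {S : Type*} [Fintype S] (q p : S → ℝ) : ℝ :=
  ∑ σ : S, q σ * Real.log (q σ / p σ)

/-- Empirical distribution of `m` samples. -/
noncomputable def empirical {S : Type*} [Fintype S] [DecidableEq S] {m : ℕ}
    (s : Fin m → S) (σ : S) : ℝ :=
  ((Finset.univ.filter (fun i => s i = σ)).card : ℝ) / m

/-- Probability of the event `A` under `m` i.i.d. draws from the distribution `p`. -/
noncomputable def prodProb {S : Type*} [Fintype S] (p : S → ℝ) (m : ℕ)
    (A : Set (Fin m → S)) : ℝ :=
  ∑ s : Fin m → S, A.indicator (fun s => ∏ i, p (s i)) s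

open MeasureTheory ProbabilityTheory in
lemma mgf_aux {S : Type*} [Fintype S] (p f : S → ℝ) (hp : ∀ σ, 0 ≤ p σ) (hp1 : ∑ σ, p σ = 1)
    (a t : ℝ) (hf : ∀ σ, a ≤ f σ ∧ f σ ≤ a + 1) (hmean : ∑ σ, p σ * f σ = 0) :
    ∑ σ, p σ * Real.exp (t * f σ) ≤ Real.exp (t ^ 2 / 8) := by
  let _ : MeasurableSpace S := ⊤
  let P : PMF S := PMF.ofFintype (fun σ => ENNReal.ofReal (p σ)) (by
    rw [← ENNReal.ofReal_sum_of_nonneg (fun i _ => hp i), hp1, ENNReal.ofReal_one])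
  have hint : ∀ g : S → ℝ, ∫ x, g x ∂P.toMeasure = ∑ σ, p σ * g σ := by
    intro g
    rw [PMF.integral_eq_sum]
    simp [P, hp]
  have h := hasSubgaussianMGF_of_mem_Icc_of_integral_eq_zero (μ := P.toMeasure) (X := f)
    (a := a) (b := a + 1) (measurable_from_top.aemeasurable)
    (Filter.Eventually.of_forall fun σ => ⟨(hf σ).1, (hf σ).2⟩) (by rw [hint, hmean])
  have h2 := h.mgf_le t
  rw [mgf, hint] at h2
  refine h2.trans (le_of_eq ?_)
  congr 1
  simp
  ring

lemma tail_aux {S : Type*} [Fintype S] [DecidableEq S] (p f : S → ℝ) (hp : ∀ σ, 0 ≤ p σ)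
    (hp1 : ∑ σ, p σ = 1)
    (a : ℝ) (hf : ∀ σ, a ≤ f σ ∧ f σ ≤ a + 1) (hmean : ∑ σ, p σ * f σ = 0)
    (m : ℕ) (lam : ℝ) (hl : 0 ≤ lam) :
    prodProb p m {s | m * lam < ∑ i, f (s i)} ≤ Real.exp (-2 * m * lam ^ 2) := by
  have h1 := mgf_aux p f hp hp1 a (4 * lam) hf hmean
  have h0 : 0 ≤ ∑ σ, p σ * Real.exp (4 * lam * f σ) :=
    Finset.sum_nonneg fun i _ => mul_nonneg (hp i) (Real.exp_pos _).le
  have h2 := pow_le_pow_left₀ h0 h1 m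
  have h3 : (∑ σ, p σ * Real.exp (4 * lam * f σ)) ^ m =
      ∑ s : Fin m → S, ∏ i, (p (s i) * Real.exp (4 * lam * f (s i))) := by
    have := Finset.prod_univ_sum (fun _ : Fin m => (Finset.univ : Finset S))
      (fun _ σ => p σ * Real.exp (4 * lam * f σ))
    simpa using this
  calc prodProb p m {s | m * lam < ∑ i, f (s i)}
      ≤ ∑ s : Fin m → S, Real.exp (-(4 * lam * (m * lam))) *
          ∏ i, (p (s i) * Real.exp (4 * lam * f (s i))) := by
        unfold prodProb
        refine Finset.sum_le_sum fun s _ => ?_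
        have hP : 0 ≤ ∏ i, p (s i) := Finset.prod_nonneg fun i _ => hp _
        rw [Finset.prod_mul_distrib, ← Real.exp_sum, ← Finset.mul_sum, mul_left_comm,
          ← Real.exp_add]
        by_cases hs : m * lam < ∑ i, f (s i)
        · rw [Set.indicator_of_mem (by exact hs)]
          refine le_mul_of_one_le_right hP (Real.one_le_exp ?_)
          nlinarith
        · rw [Set.indicator_of_notMem (by exact hs)]
          positivity
    _ = Real.exp (-(4 * lam * (m * lam))) * (∑ σ, p σ * Real.exp (4 * lam * f σ)) ^ m := by
        rw [h3, Finset.mul_sum]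
    _ ≤ Real.exp (-(4 * lam * (m * lam))) * Real.exp ((4 * lam) ^ 2 / 8) ^ m := by gcongr
    _ = Real.exp (-2 * m * lam ^ 2) := by
        rw [← Real.exp_nat_mul, ← Real.exp_add]
        congr 1
        ring

lemma Z_pos {S : Type*} [Fintype S] [Nonempty S] (E : S → ℝ) (β : ℝ) :
    0 < ∑ σ : S, Real.exp (-β * E σ) :=
  Finset.sum_pos (fun _ _ => Real.exp_pos _) Finset.univ_nonempty

lemma boltz_pos {S : Type*} [Fintype S] [Nonempty S] (E : S → ℝ) (β : ℝ) (σ : S) :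
    0 < boltz E β σ := div_pos (Real.exp_pos _) (Z_pos E β)

lemma boltz_sum {S : Type*} [Fintype S] [Nonempty S] (E : S → ℝ) (β : ℝ) :
    ∑ σ, boltz E β σ = 1 := by
  unfold boltz
  rw [← Finset.sum_div, div_self (Z_pos E β).ne']

lemma crossEnt_eq {S : Type*} [Fintype S] [Nonempty S] (q E : S → ℝ) (β : ℝ)
    (hq : ∑ σ, q σ = 1) :
    crossEnt q E β = β * ∑ σ, q σ * E σ + Real.log (∑ σ : S, Real.exp (-β * E σ)) := by
  unfold crossEnt boltz
  have : ∀ σ, q σ * Real.log (Real.exp (-β * E σ) / ∑ σ' : S, Real.exp (-β * E σ')) =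
      -(β * (q σ * E σ)) - q σ * Real.log (∑ σ' : S, Real.exp (-β * E σ')) := by
    intro σ
    rw [Real.log_div (Real.exp_pos _).ne' (Z_pos E β).ne', Real.log_exp]
    ring
  simp_rw [this]
  rw [Finset.sum_sub_distrib, ← Finset.sum_mul, hq, Finset.sum_neg_distrib, ← Finset.mul_sum]
  ring

lemma klDiv_eq {S : Type*} [Fintype S] [Nonempty S] (E : S → ℝ) (β β' : ℝ) :
    klDiv (boltz E β) (boltz E β') =
      crossEnt (boltz E β) E β' - crossEnt (boltz E β) E β := by
  unfold klDiv crossEnt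
  have : ∀ σ, boltz E β σ * Real.log (boltz E β σ / boltz E β' σ) =
      boltz E β σ * Real.log (boltz E β σ) - boltz E β σ * Real.log (boltz E β' σ) := by
    intro σ
    rw [Real.log_div (boltz_pos E β σ).ne' (boltz_pos E β' σ).ne']
    ring
  simp_rw [this]
  rw [Finset.sum_sub_distrib]
  ring

lemma empirical_sum {S : Type*} [Fintype S] [DecidableEq S] {m : ℕ} (s : Fin m → S) (g : S → ℝ) :
    ∑ σ, empirical s σ * g σ = (∑ i, g (s i)) / m := by
  unfold empirical
  have : ∑ i, g (s i) = ∑ σ, ∑ i with s i = σ, g (s i) :=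
    (Finset.sum_fiberwise _ _ _).symm
  rw [this, Finset.sum_div]
  refine Finset.sum_congr rfl fun σ _ => ?_
  have : ∑ i with s i = σ, g (s i) = ∑ i with s i = σ, g σ :=
    Finset.sum_congr rfl fun i hi => by rw [(Finset.mem_filter.1 hi).2]
  rw [this, Finset.sum_const, nsmul_eq_mul]
  ring

lemma prodProb_univ_le {S : Type*} [Fintype S] [DecidableEq S] (p : S → ℝ) (hp : ∀ σ, 0 ≤ p σ)
    (hp1 : ∑ σ, p σ = 1) (m : ℕ) (A B C : Set (Fin m → S)) (h : ∀ s, s ∈ A ∨ s ∈ B ∨ s ∈ C) :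
    1 ≤ prodProb p m A + prodProb p m B + prodProb p m C := by
  have h3 : (1 : ℝ) = ∑ s : Fin m → S, ∏ i, p (s i) := by
    have := Finset.prod_univ_sum (fun _ : Fin m => (Finset.univ : Finset S)) (fun _ σ => p σ)
    simpa [hp1] using this
  rw [h3]
  unfold prodProb
  rw [← Finset.sum_add_distrib, ← Finset.sum_add_distrib]
  refine Finset.sum_le_sum fun s _ => ?_
  have hP : 0 ≤ ∏ i, p (s i) := Finset.prod_nonneg fun i _ => hp _
  by_cases hA : s ∈ A <;> by_cases hB : s ∈ B <;> by_cases hC : s ∈ C <;>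
    simp [hA, hB, hC] <;> first | linarith | (have := h s; tauto)



theorem boltzmann_density_estimation_KL_bound
    {S : Type*} [Fintype S] [Nonempty S] [DecidableEq S]
    (E : S → ℝ) (hE : ∀ σ, 0 ≤ E σ ∧ E σ ≤ 1)
    (βstar δ : ℝ) (hδ : 0 < δ ∧ δ < 1)
    (m : ℕ) (hm : 1 ≤ m)
    (lam : ℝ) (hlam : lam = Real.sqrt (Real.log (2 / δ) / (2 * m)))
    (βhat : (Fin m → S) → ℝ)
    (hβhat : ∀ s : Fin m → S, ∀ β : ℝ,
      crossEnt (empirical s) E (βhat s) + lam * |βhat s| ≤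
        crossEnt (empirical s) E β + lam * |β|) :
    1 - δ ≤ prodProb (boltz E βstar) m
      {s | klDiv (boltz E βstar) (boltz E (βhat s)) ≤
        |βstar| / Real.sqrt m * Real.sqrt (2 * Real.log (2 / δ))} := by
  have hpos := fun σ => (boltz_pos E βstar σ).le
  have hsum := boltz_sum E βstar
  set p := boltz E βstar with hp
  set μ := ∑ σ, p σ * E σ with hμ
  have hm0 : (0 : ℝ) < m := by exact_mod_cast hm
  have hlog : 0 < Real.log (2 / δ) := Real.log_pos (by
    rw [lt_div_iff₀ hδ.1]; linarith [hδ.2])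
  have hl0 : 0 ≤ lam := hlam ▸ Real.sqrt_nonneg _
  have hl2 : lam ^ 2 = Real.log (2 / δ) / (2 * m) := by
    rw [hlam, Real.sq_sqrt (by positivity)]
  have hexp : Real.exp (-2 * m * lam ^ 2) = δ / 2 := by
    have : -2 * m * lam ^ 2 = -Real.log (2 / δ) := by
      rw [hl2]; field_simp
    rw [this, Real.exp_neg, Real.exp_log (div_pos two_pos hδ.1), inv_div]
  have hB := tail_aux p (fun σ => E σ - μ) hpos hsum (-μ)
    (fun σ => ⟨by linarith [(hE σ).1], by linarith [(hE σ).2]⟩)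
    (by simp only [mul_sub]; rw [Finset.sum_sub_distrib, ← Finset.sum_mul, hsum, ← hμ]; ring)
    m lam hl0
  have hC := tail_aux p (fun σ => μ - E σ) hpos hsum (μ - 1)
    (fun σ => ⟨by linarith [(hE σ).2], by linarith [(hE σ).1]⟩)
    (by simp only [mul_sub]; rw [Finset.sum_sub_distrib, ← Finset.sum_mul, hsum, ← hμ]; ring)
    m lam hl0
  rw [hexp] at hB hC
  have hbound : |βstar| / Real.sqrt m * Real.sqrt (2 * Real.log (2 / δ)) = 2 * lam * |βstar| := by
    have : Real.sqrt (2 * Real.log (2 / δ)) / Real.sqrt m = 2 * lam := by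
      rw [← Real.sqrt_div (by positivity), Real.sqrt_eq_iff_mul_self_eq (by positivity)
        (by positivity)]
      have : 2 * lam * (2 * lam) = 4 * lam ^ 2 := by ring
      rw [this, hl2]; field_simp; norm_num
    rw [← this]; ring
  have key := prodProb_univ_le p hpos hsum m
    {s | klDiv p (boltz E (βhat s)) ≤
        |βstar| / Real.sqrt m * Real.sqrt (2 * Real.log (2 / δ))}
    {s | m * lam < ∑ i, (E (s i) - μ)} {s | m * lam < ∑ i, (μ - E (s i))} (by
      intro s
      by_contra hcon
      simp only [Set.mem_setOf_eq, not_or, not_lt, not_le] at hcon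
      obtain ⟨h1, h2, h3⟩ := hcon
      rw [hbound, hp, klDiv_eq, ← hp, crossEnt_eq p E _ hsum, crossEnt_eq p E _ hsum, ← hμ] at h1
      have hes : ∑ σ, empirical s σ = 1 := by
        have := empirical_sum s (fun _ => 1)
        simpa [hm0.ne'] using this
      have hopt := hβhat s βstar
      rw [crossEnt_eq _ E _ hes, crossEnt_eq _ E _ hes, empirical_sum] at hopt
      set ν := (∑ i, E (s i)) / m with hν
      have hνm : ∑ i, E (s i) = m * ν := by rw [hν]; field_simp
      simp only [Finset.sum_sub_distrib, hνm, Finset.sum_const, Finset.card_univ,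
        Fintype.card_fin, nsmul_eq_mul, ← mul_sub] at h2 h3
      have h2' := le_of_mul_le_mul_left h2 hm0
      have h3' := le_of_mul_le_mul_left h3 hm0
      have habs : |ν - μ| ≤ lam := abs_le.2 ⟨by linarith, h2'⟩
      have hb : ∀ β : ℝ, |β * (ν - μ)| ≤ lam * |β| := fun β => by
        rw [abs_mul, mul_comm]; gcongr
      have e1 := (abs_le.1 (hb βstar)).2
      have e2 := (abs_le.1 (hb (βhat s))).1
      linarith)
  linarith
end

section
/- Let G be a simple graph on a finite vertex set V, let 0 < A < B be reals, and define E(q) = −A·Σ_{i∈V} q_i + B·Σ_{{i,j}∈E(G)} q_i q_j for q : V → {0,1}. Then q : V → {0,1} is a global minimizer of E if and only if {i : q_i = 1} is an independent set of G of maximum cardinality, and the minimum value of E equals −A·α(G), where α(G) is the independence number of G. -/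
open scoped BigOperators

/-- The independence number of a graph: the maximum cardinality of a set of
pairwise non-adjacent vertices. -/
noncomputable def indepNum {V : Type*} [Fintype V] (G : SimpleGraph V) : ℕ :=
  sSup {n : ℕ | ∃ s : Finset V, (∀ i ∈ s, ∀ j ∈ s, ¬ G.Adj i j) ∧ s.card = n}

theorem indepNum_bdd {V : Type*} [Fintype V] (G : SimpleGraph V) :
    BddAbove {n : ℕ | ∃ s : Finset V, (∀ i ∈ s, ∀ j ∈ s, ¬ G.Adj i j) ∧ s.card = n} := by
  refine ⟨Fintype.card V, ?_⟩
  rintro n ⟨s, -, rfl⟩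
  exact s.card_le_univ

theorem card_le_indepNum' {V : Type*} [Fintype V] (G : SimpleGraph V) (s : Finset V)
    (hs : ∀ i ∈ s, ∀ j ∈ s, ¬ G.Adj i j) : s.card ≤ indepNum G :=
  le_csSup (indepNum_bdd G) ⟨s, hs, rfl⟩

theorem exists_indepNum' {V : Type*} [Fintype V] (G : SimpleGraph V) :
    ∃ s : Finset V, (∀ i ∈ s, ∀ j ∈ s, ¬ G.Adj i j) ∧ s.card = indepNum G :=
  Nat.sSup_mem (s := {n : ℕ | ∃ s : Finset V, (∀ i ∈ s, ∀ j ∈ s, ¬ G.Adj i j) ∧ s.card = n})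
    ⟨0, ∅, by simp, by simp⟩ (indepNum_bdd G)

theorem energy_key {V : Type*} [Fintype V] [DecidableEq V]
    (G : SimpleGraph V) [DecidableRel G.Adj] (q : V → ℝ) (hq : ∀ k, q k = 0 ∨ q k = 1) :
    ∃ (s : Finset V) (m : ℕ), (∀ i, i ∈ s ↔ q i = 1) ∧ (∑ i : V, q i) = s.card ∧
      (∑ e ∈ G.edgeFinset,
          Sym2.lift ⟨fun i j => q i * q j, fun i j => by ring⟩ e) = (m : ℝ) ∧
      s.card ≤ indepNum G + m ∧ (m = 0 ↔ ∀ i ∈ s, ∀ j ∈ s, ¬ G.Adj i j) := by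
  classical
  let s : Finset V := Finset.univ.filter (fun i => q i = 1)
  have hs : ∀ i, i ∈ s ↔ q i = 1 := by simp [s]
  let F : Finset (Sym2 V) := G.edgeFinset.filter (fun e => ∀ v ∈ e, v ∈ s)
  have hF : ∀ i j, s(i, j) ∈ F ↔ G.Adj i j ∧ i ∈ s ∧ j ∈ s := by
    intro i j
    simp [F]
  refine ⟨s, F.card, hs, ?_, ?_, ?_, ?_⟩
  · have : ∀ i, q i = if q i = 1 then 1 else 0 := by
      intro i
      rcases hq i with h | h <;> simp [h]
    rw [Finset.sum_congr rfl (fun i _ => this i)]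
    simp [s]
  · rw [Finset.card_filter, Nat.cast_sum]
    refine Finset.sum_congr rfl ?_
    intro e _
    induction e using Sym2.ind with
    | _ i j =>
      rcases hq i with h | h <;> rcases hq j with h' | h' <;> simp [hs, h, h']
  · let t := s \ F.image (fun e => e.out.1)
    have ht : t.card ≤ indepNum G := by
      apply card_le_indepNum'
      intro i hi j hj hadj
      simp only [t, Finset.mem_sdiff, Finset.mem_image, not_exists, not_and] at hi hj
      have he : s(i, j) ∈ F := (hF i j).2 ⟨hadj, hi.1, hj.1⟩
      have hm : (s(i, j)).out.1 ∈ s(i, j) := Sym2.out_fst_mem _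
      rcases Sym2.mem_iff.1 hm with h | h
      · exact hi.2 _ he h
      · exact hj.2 _ he h
    have h1 : (F.image (fun e => e.out.1)).card ≤ F.card := Finset.card_image_le
    have h2 : s.card - (F.image (fun e => e.out.1)).card ≤ t.card :=
      Finset.le_card_sdiff _ _
    omega
  · rw [Finset.card_eq_zero, Finset.eq_empty_iff_forall_notMem]
    constructor
    · intro h i hi j hj hadj
      exact h _ ((hF i j).2 ⟨hadj, hi, hj⟩)
    · intro h e
      induction e using Sym2.ind with
      | _ i j =>
        rw [hF]
        rintro ⟨a, b, c⟩
        exact h i b j c a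

theorem mis_energy_minimizers_iff_maximum_independent_sets
    {V : Type*} [Fintype V] [DecidableEq V]
    (G : SimpleGraph V) [DecidableRel G.Adj]
    (A B : ℝ) (hA : 0 < A) (hAB : A < B)
    (Eng : (V → ℝ) → ℝ)
    (hEng : ∀ q : V → ℝ, Eng q =
      -A * (∑ i : V, q i) +
        B * ∑ e ∈ G.edgeFinset,
          Sym2.lift ⟨fun i j => q i * q j, fun i j => by ring⟩ e) :
    (∀ q : V → ℝ, (∀ k, q k = 0 ∨ q k = 1) →
      ((∀ q' : V → ℝ, (∀ k, q' k = 0 ∨ q' k = 1) → Eng q ≤ Eng q') ↔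
        ((∀ i j : V, q i = 1 → q j = 1 → ¬ G.Adj i j) ∧
          {i : V | q i = 1}.ncard = indepNum G)))
    ∧ IsLeast {x : ℝ | ∃ q : V → ℝ, (∀ k, q k = 0 ∨ q k = 1) ∧ Eng q = x}
        (-A * (indepNum G : ℝ)) := by
  have lower : ∀ q : V → ℝ, (∀ k, q k = 0 ∨ q k = 1) → -A * (indepNum G : ℝ) ≤ Eng q ∧
      (Eng q = -A * (indepNum G : ℝ) ↔ ((∀ i j : V, q i = 1 → q j = 1 → ¬ G.Adj i j) ∧
          {i : V | q i = 1}.ncard = indepNum G)) := by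
    intro q hq
    obtain ⟨s, m, hs, h1, h2, h3, h4⟩ := energy_key G q hq
    have hE : Eng q = -A * s.card + B * m := by rw [hEng, h1, h2]
    have hset : {i : V | q i = 1} = (s : Set V) := by
      ext i
      simp [hs]
    have h3' : (s.card : ℝ) ≤ indepNum G + m := by exact_mod_cast h3
    have h5 : A * s.card ≤ A * (indepNum G + m) := mul_le_mul_of_nonneg_left h3' hA.le
    have hm : (0 : ℝ) ≤ m := Nat.cast_nonneg m
    have h6 : 0 ≤ (B - A) * m := mul_nonneg (by linarith) hm
    rw [hset, Set.ncard_coe_finset, hE]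
    refine ⟨by linarith, ?_, ?_⟩
    · intro h
      have h7 : (B - A) * m = 0 := by linarith
      have h8 : (m : ℝ) = 0 := by
        rcases mul_eq_zero.1 h7 with h | h
        · linarith
        · exact h
      have h9 : m = 0 := by exact_mod_cast h8
      refine ⟨fun i j hi hj => h4.1 h9 i ((hs i).2 hi) j ((hs j).2 hj), ?_⟩
      rw [h8] at h
      have : A * (s.card : ℝ) = A * indepNum G := by linarith
      exact_mod_cast mul_left_cancel₀ hA.ne' this
    · rintro ⟨hi, hc⟩
      have : m = 0 := h4.2 (fun i a j b => hi i j ((hs i).1 a) ((hs j).1 b))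
      rw [hc, this]
      simp
  have attain : ∃ q : V → ℝ, (∀ k, q k = 0 ∨ q k = 1) ∧ Eng q = -A * (indepNum G : ℝ) := by
    obtain ⟨s, hs, hc⟩ := exists_indepNum' G
    have hq : ∀ k, (fun i => if i ∈ s then (1 : ℝ) else 0) k = 0 ∨
        (fun i => if i ∈ s then (1 : ℝ) else 0) k = 1 := by
      intro k
      by_cases h : k ∈ s <;> simp [h]
    refine ⟨_, hq, (lower _ hq).2.2 ⟨?_, ?_⟩⟩
    · intro i j hi hj
      exact hs i (by simpa using hi) j (by simpa using hj)
    · rw [← hc, ← Set.ncard_coe_finset]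
      congr 1
      ext i
      simp
  obtain ⟨q₀, hq₀, hE₀⟩ := attain
  refine ⟨fun q hq => ?_, ⟨q₀, hq₀, hE₀⟩, ?_⟩
  · rw [← (lower q hq).2]
    constructor
    · intro h
      exact le_antisymm (hE₀ ▸ h q₀ hq₀) (lower q hq).1
    · intro h q' hq'
      rw [h]
      exact (lower q' hq').1
  · rintro x ⟨q, hq, rfl⟩
    exact (lower q hq).1
end

section
/- Let G be a simple graph on a finite vertex set V, let 0 < A < B be reals, and define E(q) = A·Σ_{i∈V} q_i + B·Σ_{{i,j}∈E(G)} (1 − q_i)(1 − q_j) for q : V → {0,1}. Then q is a global minimizer of E if and only if {i : q_i = 1} is a vertex cover of G of minimum cardinality, and the minimum value of E equals A·τ(G), where τ(G) is the minimum cardinality of a vertex cover of G. -/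
open scoped BigOperators

/-- The vertex-cover number of a graph: the minimum cardinality of a set of
vertices containing at least one endpoint of every edge. -/
noncomputable def coverNum {V : Type*} [Fintype V] (G : SimpleGraph V) : ℕ :=
  sInf {n : ℕ | ∃ s : Finset V, (∀ i j : V, G.Adj i j → i ∈ s ∨ j ∈ s) ∧ s.card = n}

theorem coverNum_le_aux {V : Type*} [Fintype V] (G : SimpleGraph V) (s : Finset V)
    (h : ∀ i j : V, G.Adj i j → i ∈ s ∨ j ∈ s) : coverNum G ≤ s.card :=
  Nat.sInf_le ⟨s, h, rfl⟩

theorem coverNum_exists_aux {V : Type*} [Fintype V] (G : SimpleGraph V) :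
    ∃ s : Finset V, (∀ i j : V, G.Adj i j → i ∈ s ∨ j ∈ s) ∧ s.card = coverNum G :=
  Nat.sInf_mem (s := {n : ℕ | ∃ s : Finset V,
    (∀ i j : V, G.Adj i j → i ∈ s ∨ j ∈ s) ∧ s.card = n})
    ⟨_, Finset.univ, fun _ _ _ => Or.inl (Finset.mem_univ _), rfl⟩

theorem energy_aux {V : Type*} [Fintype V] [DecidableEq V]
    (G : SimpleGraph V) [DecidableRel G.Adj] (q : V → ℝ) (hq : ∀ k, q k = 0 ∨ q k = 1) :
    (∑ i : V, q i = ({i : V | q i = 1}.ncard : ℝ)) ∧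
    ∃ u : ℕ, (∑ e ∈ G.edgeFinset,
        Sym2.lift ⟨fun i j => (1 - q i) * (1 - q j), fun i j => by ring⟩ e = (u : ℝ)) ∧
      coverNum G ≤ {i : V | q i = 1}.ncard + u ∧
      (u = 0 ↔ ∀ i j : V, G.Adj i j → q i = 1 ∨ q j = 1) := by
  classical
  have hn : {i : V | q i = 1}.ncard = (Finset.univ.filter (fun i => q i = 1)).card := by
    rw [← Set.ncard_coe_finset]; simp
  rw [hn]
  refine ⟨?_, (G.edgeFinset.filter (fun e => ∀ v ∈ e, q v = 0)).card, ?_, ?_, ?_⟩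
  · rw [Finset.card_filter]
    push_cast
    refine Finset.sum_congr rfl fun i _ => ?_
    rcases hq i with h | h <;> simp [h]
  · rw [Finset.card_filter]
    push_cast
    refine Finset.sum_congr rfl fun e _ => ?_
    induction e using Sym2.ind with
    | _ i j => rcases hq i with h | h <;> rcases hq j with h' | h' <;> simp [h, h']
  · refine le_trans (coverNum_le_aux G (Finset.univ.filter (fun i => q i = 1) ∪
      (G.edgeFinset.filter (fun e => ∀ v ∈ e, q v = 0)).image (fun e => e.out.1)) ?_) ?_
    · intro i j hij
      by_cases h : q i = 1
      · left; simp [h]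
      by_cases h' : q j = 1
      · right; simp [h']
      have hi := (hq i).resolve_right h
      have hj := (hq j).resolve_right h'
      have hm : (s(i, j)).out.1 ∈ (G.edgeFinset.filter
          (fun e => ∀ v ∈ e, q v = 0)).image (fun e => e.out.1) := by
        refine Finset.mem_image_of_mem (fun e : Sym2 V => e.out.1) ?_
        simp [hij, hi, hj]
      rcases Sym2.mem_iff.1 (Sym2.out_fst_mem s(i, j)) with h1 | h1
      · left; rw [h1] at hm; exact Finset.mem_union_right _ hm
      · right; rw [h1] at hm; exact Finset.mem_union_right _ hm
    · exact (Finset.card_union_le _ _).trans (Nat.add_le_add_left Finset.card_image_le _)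
  · rw [Finset.card_eq_zero, Finset.filter_eq_empty_iff]
    constructor
    · intro h i j hij
      have := h (x := s(i, j)) (by simpa using hij)
      by_contra! hc
      exact this (by simp [(hq i).resolve_right hc.1, (hq j).resolve_right hc.2])
    · intro h e he hc
      induction e using Sym2.ind with
      | _ i j =>
        have h0 := hc i (by simp)
        have h1 := hc j (by simp)
        rcases h i j (by simpa using he) with h2 | h2 <;> simp_all

theorem mvc_energy_minimizers_iff_minimum_vertex_covers
    {V : Type*} [Fintype V] [DecidableEq V]
    (G : SimpleGraph V) [DecidableRel G.Adj]
    (A B : ℝ) (hA : 0 < A) (hAB : A < B)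
    (Eng : (V → ℝ) → ℝ)
    (hEng : ∀ q : V → ℝ, Eng q =
      A * (∑ i : V, q i) +
        B * ∑ e ∈ G.edgeFinset,
          Sym2.lift ⟨fun i j => (1 - q i) * (1 - q j), fun i j => by ring⟩ e) :
    (∀ q : V → ℝ, (∀ k, q k = 0 ∨ q k = 1) →
      ((∀ q' : V → ℝ, (∀ k, q' k = 0 ∨ q' k = 1) → Eng q ≤ Eng q') ↔
        ((∀ i j : V, G.Adj i j → q i = 1 ∨ q j = 1) ∧
          {i : V | q i = 1}.ncard = coverNum G)))
    ∧ IsLeast {x : ℝ | ∃ q : V → ℝ, (∀ k, q k = 0 ∨ q k = 1) ∧ Eng q = x}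
        (A * (coverNum G : ℝ)) := by
  have hlow : ∀ q : V → ℝ, (∀ k, q k = 0 ∨ q k = 1) → A * (coverNum G : ℝ) ≤ Eng q := by
    intro q hq
    obtain ⟨h1, u, h2, h3, h4⟩ := energy_aux G q hq
    rw [hEng, h1, h2]
    have h3' : (coverNum G : ℝ) ≤ {i : V | q i = 1}.ncard + u := by exact_mod_cast h3
    have hu : (0 : ℝ) ≤ u := Nat.cast_nonneg u
    nlinarith [mul_le_mul_of_nonneg_left h3' hA.le, mul_nonneg (sub_pos.2 hAB).le hu]
  have hval : ∀ q : V → ℝ, (∀ k, q k = 0 ∨ q k = 1) →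
      (∀ i j : V, G.Adj i j → q i = 1 ∨ q j = 1) →
      Eng q = A * ({i : V | q i = 1}.ncard : ℝ) := by
    intro q hq hc
    obtain ⟨h1, u, h2, h3, h4⟩ := energy_aux G q hq
    rw [hEng, h1, h2, h4.2 hc]
    simp
  have hex : ∃ q : V → ℝ, (∀ k, q k = 0 ∨ q k = 1) ∧ Eng q = A * (coverNum G : ℝ) := by
    obtain ⟨s, hs, hcard⟩ := coverNum_exists_aux G
    have hb : ∀ k, (fun i => if i ∈ s then (1 : ℝ) else 0) k = 0 ∨
        (fun i => if i ∈ s then (1 : ℝ) else 0) k = 1 := by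
      intro k
      by_cases h : k ∈ s <;> simp [h]
    refine ⟨fun i => if i ∈ s then 1 else 0, hb, ?_⟩
    rw [hval _ hb (by simpa using hs), ← hcard]
    simp
  refine ⟨fun q hq => ⟨fun hmin => ?_, fun hc q' hq' => ?_⟩, hex, ?_⟩
  · obtain ⟨q0, hq0, he0⟩ := hex
    have hle := hmin q0 hq0
    rw [he0] at hle
    obtain ⟨h1, u, h2, h3, h4⟩ := energy_aux G q hq
    rw [hEng, h1, h2] at hle
    have h3' : (coverNum G : ℝ) ≤ {i : V | q i = 1}.ncard + u := by exact_mod_cast h3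
    have hu : u = 0 := by
      by_contra h
      have hu : (0 : ℝ) < u := Nat.cast_pos.2 (Nat.pos_of_ne_zero h)
      nlinarith [mul_le_mul_of_nonneg_left h3' hA.le, mul_pos (sub_pos.2 hAB) hu]
    subst hu
    refine ⟨h4.1 rfl, le_antisymm ?_ (by simpa using h3)⟩
    have : ({i : V | q i = 1}.ncard : ℝ) ≤ coverNum G :=
      le_of_mul_le_mul_left (by simpa using hle) hA
    exact_mod_cast this
  · rw [hval q hq hc.1, hc.2]
    exact hlow q' hq'
  · rintro x ⟨q, hq, rfl⟩
    exact hlow q hq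
end

section
/- Let G be a simple graph on a finite vertex set V, let 0 < A < B be reals, and define the MaxCl energy on q : V → {0,1} as E(q) = −A·Σ_{i∈V} q_i + B·Σ_{{i,j}∉E(G), i≠j} q_i q_j, where the second sum ranges over unordered pairs of distinct non-adjacent vertices. Then q is a global minimizer of E if and only if {i : q_i = 1} is a clique of G of maximum cardinality, and the minimum value of E equals −A·ω(G), where ω(G) is the clique number of G. -/
open scoped BigOperators

/-- The clique number of a graph: the maximum cardinality of a set of
pairwise adjacent vertices. -/
noncomputable def cliqueNum' {V : Type*} [Fintype V] (G : SimpleGraph V) : ℕ :=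
  sSup {n : ℕ | ∃ s : Finset V, (∀ i ∈ s, ∀ j ∈ s, i ≠ j → G.Adj i j) ∧ s.card = n}


theorem cliqueNum'_bdd {V : Type*} [Fintype V] (G : SimpleGraph V) :
    BddAbove {n : ℕ | ∃ s : Finset V, (∀ i ∈ s, ∀ j ∈ s, i ≠ j → G.Adj i j) ∧ s.card = n} := by
  refine ⟨Fintype.card V, ?_⟩
  rintro n ⟨s, -, rfl⟩
  exact Finset.card_le_univ s

theorem le_cliqueNum' {V : Type*} [Fintype V] (G : SimpleGraph V) (s : Finset V)
    (hs : ∀ i ∈ s, ∀ j ∈ s, i ≠ j → G.Adj i j) : s.card ≤ cliqueNum' G :=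
  le_csSup (cliqueNum'_bdd G) ⟨s, hs, rfl⟩

theorem exists_cliqueNum' {V : Type*} [Fintype V] (G : SimpleGraph V) :
    ∃ s : Finset V, (∀ i ∈ s, ∀ j ∈ s, i ≠ j → G.Adj i j) ∧ s.card = cliqueNum' G := by
  have hne : {n : ℕ | ∃ s : Finset V, (∀ i ∈ s, ∀ j ∈ s, i ≠ j → G.Adj i j) ∧
      s.card = n}.Nonempty := ⟨0, ∅, by simp, by simp⟩
  exact Nat.sSup_mem hne (cliqueNum'_bdd G)

/-- non-adjacent pairs inside `S` -/
def badPairs {V : Type*} [Fintype V] [DecidableEq V] (G : SimpleGraph V) [DecidableRel G.Adj]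
    (S : Finset V) : Finset (Sym2 V) :=
  Gᶜ.edgeFinset.filter (fun e => ∀ v ∈ e, v ∈ S)

theorem mk_mem_badPairs {V : Type*} [Fintype V] [DecidableEq V] (G : SimpleGraph V)
    [DecidableRel G.Adj] (S : Finset V) (i j : V) :
    s(i, j) ∈ badPairs G S ↔ (i ≠ j ∧ ¬ G.Adj i j) ∧ i ∈ S ∧ j ∈ S := by
  simp [badPairs]

theorem badPairs_card_eq_zero {V : Type*} [Fintype V] [DecidableEq V] (G : SimpleGraph V)
    [DecidableRel G.Adj] (S : Finset V) :
    (badPairs G S).card = 0 ↔ ∀ i ∈ S, ∀ j ∈ S, i ≠ j → G.Adj i j := by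
  rw [Finset.card_eq_zero, Finset.eq_empty_iff_forall_notMem]
  constructor
  · intro h i hi j hj hij
    by_contra hn
    exact h s(i, j) ((mk_mem_badPairs G S i j).2 ⟨⟨hij, hn⟩, hi, hj⟩)
  · intro h e
    induction e with
    | h i j =>
      rw [mk_mem_badPairs]
      rintro ⟨⟨hij, hn⟩, hi, hj⟩
      exact hn (h i hi j hj hij)

theorem card_le_cliqueNum'_add {V : Type*} [Fintype V] [DecidableEq V] (G : SimpleGraph V)
    [DecidableRel G.Adj] (n : ℕ) : ∀ S : Finset V, S.card = n →
    S.card ≤ cliqueNum' G + (badPairs G S).card := by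
  induction n with
  | zero => intro S hS; omega
  | succ n ih =>
    intro S hS
    by_cases h : ∀ i ∈ S, ∀ j ∈ S, i ≠ j → G.Adj i j
    · exact (le_cliqueNum' G S h).trans (Nat.le_add_right _ _)
    · push Not at h
      obtain ⟨i, hi, j, hj, hij, hn⟩ := h
      have hc := Finset.card_erase_of_mem hi
      have h1 := ih (S.erase i) (by omega)
      have h2 : (badPairs G (S.erase i)).card < (badPairs G S).card := by
        apply Finset.card_lt_card
        rw [Finset.ssubset_iff_of_subset]
        · exact ⟨s(i, j), (mk_mem_badPairs G S i j).2 ⟨⟨hij, hn⟩, hi, hj⟩, by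
            rw [mk_mem_badPairs]; simp⟩
        · intro e he
          simp only [badPairs, Finset.mem_filter] at he ⊢
          exact ⟨he.1, fun v hv => Finset.mem_of_mem_erase (he.2 v hv)⟩
      omega

theorem maxcl_energy_minimizers_iff_maximum_cliques
    {V : Type*} [Fintype V] [DecidableEq V]
    (G : SimpleGraph V) [DecidableRel G.Adj]
    (A B : ℝ) (hA : 0 < A) (hAB : A < B)
    (Eng : (V → ℝ) → ℝ)
    -- the second sum ranges over unordered pairs of distinct non-adjacent vertices,
    -- i.e. over the edges of the complement graph
    (hEng : ∀ q : V → ℝ, Eng q =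
      -A * (∑ i : V, q i) +
        B * ∑ e ∈ Gᶜ.edgeFinset,
          Sym2.lift ⟨fun i j => q i * q j, fun i j => by ring⟩ e) :
    (∀ q : V → ℝ, (∀ k, q k = 0 ∨ q k = 1) →
      ((∀ q' : V → ℝ, (∀ k, q' k = 0 ∨ q' k = 1) → Eng q ≤ Eng q') ↔
        ((∀ i j : V, q i = 1 → q j = 1 → i ≠ j → G.Adj i j) ∧
          {i : V | q i = 1}.ncard = cliqueNum' G)))
    ∧ IsLeast {x : ℝ | ∃ q : V → ℝ, (∀ k, q k = 0 ∨ q k = 1) ∧ Eng q = x}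
        (-A * (cliqueNum' G : ℝ)) := by
  classical
  have key : ∀ q : V → ℝ, (∀ k, q k = 0 ∨ q k = 1) → Eng q =
      -A * ((Finset.univ.filter (fun i => q i = 1)).card : ℝ) +
        B * ((badPairs G (Finset.univ.filter (fun i => q i = 1))).card : ℝ) := by
    intro q hq
    rw [hEng]
    congr 2
    · rw [Finset.card_filter]
      push_cast
      refine Finset.sum_congr rfl fun i _ => ?_
      rcases hq i with h | h <;> simp [h]
    · rw [badPairs, Finset.card_filter]
      push_cast
      refine Finset.sum_congr rfl fun e _ => ?_
      induction e with
      | h i j =>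
        rcases hq i with h | h <;> rcases hq j with h' | h' <;> simp [h, h']
  have lb : ∀ q : V → ℝ, (∀ k, q k = 0 ∨ q k = 1) →
      -A * (cliqueNum' G : ℝ) ≤ Eng q ∧ (Eng q ≤ -A * (cliqueNum' G : ℝ) ↔
        ((∀ i j : V, q i = 1 → q j = 1 → i ≠ j → G.Adj i j) ∧
          {i : V | q i = 1}.ncard = cliqueNum' G)) := by
    intro q hq
    have hk := key q hq
    have hnc : {i : V | q i = 1}.ncard = (Finset.univ.filter (fun i => q i = 1)).card := by
      rw [← Set.ncard_coe_finset]; simp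
    have hz := badPairs_card_eq_zero G (Finset.univ.filter (fun i => q i = 1))
    have hle := card_le_cliqueNum'_add G _ (Finset.univ.filter (fun i => q i = 1)) rfl
    have hcl : (∀ i j : V, q i = 1 → q j = 1 → i ≠ j → G.Adj i j) ↔
        (badPairs G (Finset.univ.filter (fun i => q i = 1))).card = 0 := by
      rw [hz]
      simp only [Finset.mem_filter, Finset.mem_univ, true_and]
      exact ⟨fun h i hi j hj => h i j hi hj, fun h i j hi hj => h i hi j hj⟩
    rw [hcl, hnc, hk]
    generalize (badPairs G (Finset.univ.filter (fun i => q i = 1))).card = m at *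
    generalize (Finset.univ.filter (fun i => q i = 1)).card = c at *
    have hle' : (c : ℝ) ≤ cliqueNum' G + m := by exact_mod_cast hle
    have hm : (0 : ℝ) ≤ m := Nat.cast_nonneg m
    have h1 := mul_le_mul_of_nonneg_left hle' hA.le
    have h2 := mul_nonneg (sub_pos.2 hAB).le hm
    refine ⟨by linarith, fun h => ?_, ?_⟩
    · have hm0 : m = 0 := by
        by_contra hne
        have : (0 : ℝ) < m := by exact_mod_cast Nat.pos_of_ne_zero hne
        have := mul_pos (sub_pos.2 hAB) this
        linarith
      subst hm0
      refine ⟨rfl, le_antisymm (by simpa using hle) ?_⟩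
      have : A * (cliqueNum' G : ℝ) ≤ A * c := by
        simp at h; linarith
      exact_mod_cast le_of_mul_le_mul_left this hA
    · rintro ⟨rfl, rfl⟩
      simp
  obtain ⟨s, hs, hsc⟩ := exists_cliqueNum' G
  have hq0 : ∀ k, (fun i => if i ∈ s then (1 : ℝ) else 0) k = 0 ∨
      (fun i => if i ∈ s then (1 : ℝ) else 0) k = 1 := by
    intro k
    by_cases h : k ∈ s <;> simp [h]
  have hE0 : Eng (fun i => if i ∈ s then (1 : ℝ) else 0) ≤ -A * (cliqueNum' G : ℝ) := by
    rw [(lb _ hq0).2]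
    constructor
    · intro i j hi hj hij
      refine hs i ?_ j ?_ hij
      · by_contra h; simp [h] at hi
      · by_contra h; simp [h] at hj
    · rw [← hsc, ← Set.ncard_coe_finset]
      congr 1
      ext i
      simp
  refine ⟨fun q hq => ?_, ⟨_, hq0, le_antisymm hE0 (lb _ hq0).1⟩, ?_⟩
  · rw [← (lb q hq).2]
    exact ⟨fun h => (h _ hq0).trans hE0, fun h q' hq' => h.trans (lb q' hq').1⟩
  · rintro x ⟨q, hq, rfl⟩
    exact (lb q hq).1
end
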